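/- Assume ρ̂ = ρ + αλ_min − ζ̃_{L*−K} > 0, and let ε ∈ (0, χ/2) and γ ∈ [ε, χ − ε]. Then Fix T^γ is a singleton {z*}, and for every z ∈ H, ‖T^γ z − z*‖ ≤ √(1 − ε·min{κ_K²ε/2, ρ̂}) · ‖z − z*‖. -/

import Mathlib

open Filter Topology
open scoped RealInnerProductSpace Pointwise

noncomputable section

variable {H G : Type*}

/-- A set-valued operator `A` is `ρ`-monotone. -/
def IsMonotoneSV [NormedAddCommGroup H] [InnerProductSpace ℝ H]
    (ρ : ℝ) (A : H → Set H) : Prop :=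
  ∀ x y u v, u ∈ A x → v ∈ A y → ρ * ‖x - y‖ ^ 2 ≤ ⟪x - y, u - v⟫

/-- `A` is maximally `ρ`-monotone: it is `ρ`-monotone and its graph is maximal, under
inclusion, among graphs of `ρ`-monotone operators. -/
def IsMaxMonotoneSV [NormedAddCommGroup H] [InnerProductSpace ℝ H]
    (ρ : ℝ) (A : H → Set H) : Prop :=
  IsMonotoneSV ρ A ∧
    ∀ A' : H → Set H, IsMonotoneSV ρ A' → (∀ x, A x ⊆ A' x) → ∀ x, A' x = A x

/-- `C` is `β`-cocoercive. -/
def IsCocoercive [NormedAddCommGroup H] [InnerProductSpace ℝ H]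
    (β : ℝ) (C : H → H) : Prop :=
  ∀ x y, β * ‖C x - C y‖ ^ 2 ≤ ⟪x - y, C x - C y⟫

/-- `k` is a Lipschitz bound for `f`. -/
def IsLipBound {E F : Type*} [NormedAddCommGroup E] [NormedAddCommGroup F]
    (k : ℝ) (f : E → F) : Prop :=
  ∀ x y, ‖f x - f y‖ ≤ k * ‖x - y‖

/-- `k` is the (smallest) Lipschitz constant of `f`. -/
def IsLipConst {E F : Type*} [NormedAddCommGroup E] [NormedAddCommGroup F]
    (k : ℝ) (f : E → F) : Prop :=
  IsLipBound k f ∧ ∀ k', IsLipBound k' f → k ≤ k'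

/-- A single-valued map `B` is monotone. -/
def IsMonotoneMap [NormedAddCommGroup G] [InnerProductSpace ℝ G]
    (B : G → G) : Prop :=
  ∀ x y, (0:ℝ) ≤ ⟪x - y, B x - B y⟫

/-- The operator `D_M : x ↦ α M (L x - c) + M (B (L x))`. -/
def Dop [NormedAddCommGroup H] [InnerProductSpace ℝ H]
    [NormedAddCommGroup G] [InnerProductSpace ℝ G]
    (α : ℝ) (L : H →L[ℝ] G) (c : G) (B : G → G) (M : G →L[ℝ] H) : H → H :=
  fun x => α • M (L x - c) + M (B (L x))

/-- `λ_min = inf {⟪x, K (L x)⟫ : ‖x‖ = 1}`. -/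
def lambdaMin [NormedAddCommGroup H] [InnerProductSpace ℝ H]
    [NormedAddCommGroup G] [InnerProductSpace ℝ G]
    (L : H →L[ℝ] G) (K : G →L[ℝ] H) : ℝ :=
  sInf {r : ℝ | ∃ x : H, ‖x‖ = 1 ∧ r = ⟪x, K (L x)⟫}

/-- The step-size bound `χ`. -/
def chiConst (β ρ κ : ℝ) : ℝ :=
  if 0 ≤ ρ then 4 * β / (1 + Real.sqrt (1 + 16 * β ^ 2 * κ ^ 2))
  else min (4 * β / (1 + Real.sqrt (1 + 16 * β ^ 2 * κ ^ 2))) (-1 / ρ)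
theorem lambdaMin_mul_norm_sq_le [NormedAddCommGroup H] [InnerProductSpace ℝ H]
    [NormedAddCommGroup G] [InnerProductSpace ℝ G] (L : H →L[ℝ] G) (K : G →L[ℝ] H) (v : H) :
    lambdaMin L K * ‖v‖ ^ 2 ≤ ⟪v, K (L v)⟫ := by
  rcases eq_or_ne v 0 with rfl | hv
  · simp
  have hn : 0 < ‖v‖ := norm_pos_iff.mpr hv
  have hbdd : BddBelow {r : ℝ | ∃ x : H, ‖x‖ = 1 ∧ r = ⟪x, K (L x)⟫} := by
    refine ⟨-‖K.comp L‖, ?_⟩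
    rintro r ⟨x, hx, rfl⟩
    have h1 := abs_real_inner_le_norm x (K (L x))
    have h2 := (K.comp L).le_opNorm x
    rw [hx, mul_one, ContinuousLinearMap.comp_apply] at h2
    rw [hx, one_mul] at h1
    linarith [neg_abs_le ⟪x, K (L x)⟫]
  have h : lambdaMin L K ≤ ⟪‖v‖⁻¹ • v, K (L (‖v‖⁻¹ • v))⟫ :=
    csInf_le hbdd ⟨_, norm_smul_inv_norm hv, rfl⟩
  simp only [map_smul, real_inner_smul_left, real_inner_smul_right] at h
  calc lambdaMin L K * ‖v‖ ^ 2
      ≤ (‖v‖⁻¹ * (‖v‖⁻¹ * ⟪v, K (L v)⟫)) * ‖v‖ ^ 2 := by gcongr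
    _ = ⟪v, K (L v)⟫ := by field_simp

theorem inner_Dop_sub_ge [NormedAddCommGroup H] [InnerProductSpace ℝ H] [CompleteSpace H]
    [NormedAddCommGroup G] [InnerProductSpace ℝ G] [CompleteSpace G]
    {α ζt : ℝ} {B : G → G} {L : H →L[ℝ] G} {K : G →L[ℝ] H} (c : G)
    (hB : IsMonotoneMap B) (hα : 0 ≤ α)
    (hζt : IsLipBound ζt (fun x : H => (ContinuousLinearMap.adjoint L - K) (B (L x))))
    (x y : H) :
    (α * lambdaMin L K - ζt) * ‖x - y‖ ^ 2 ≤
      ⟪x - y, Dop α L c B K x - Dop α L c B K y⟫ := by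
  have h1 := mul_le_mul_of_nonneg_left (lambdaMin_mul_norm_sq_le L K (x - y)) hα
  have h2 := hB (L x) (L y)
  have h3 := real_inner_le_norm (x - y) ((ContinuousLinearMap.adjoint L - K) (B (L x)) -
    (ContinuousLinearMap.adjoint L - K) (B (L y)))
  have h4 := mul_le_mul_of_nonneg_left (hζt x y) (norm_nonneg (x - y))
  have h5 : ⟪x - y, (ContinuousLinearMap.adjoint L - K) (B (L x)) -
      (ContinuousLinearMap.adjoint L - K) (B (L y))⟫ =
      ⟪L x - L y, B (L x) - B (L y)⟫ - ⟪x - y, K (B (L x)) - K (B (L y))⟫ := by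
    rw [← map_sub, sub_apply, inner_sub_right,
      ContinuousLinearMap.adjoint_inner_right, map_sub, map_sub]
  have h6 : Dop α L c B K x - Dop α L c B K y =
      α • K (L (x - y)) + (K (B (L x)) - K (B (L y))) := by
    simp only [Dop, map_sub, smul_sub]
    abel
  rw [h6, inner_add_right, real_inner_smul_right]
  nlinarith

theorem norm_Dop_sub_le [NormedAddCommGroup H] [InnerProductSpace ℝ H]
    [NormedAddCommGroup G] [InnerProductSpace ℝ G]
    {α κ : ℝ} {B : G → G} {L : H →L[ℝ] G} {K : G →L[ℝ] H} (c : G)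
    (hκ : IsLipBound κ (fun x : H => K (α • L x + B (L x)))) (x y : H) :
    ‖Dop α L c B K x - Dop α L c B K y‖ ≤ κ * ‖x - y‖ := by
  have h : Dop α L c B K x - Dop α L c B K y =
      K (α • L x + B (L x)) - K (α • L y + B (L y)) := by
    simp only [Dop, map_sub, map_add, map_smul, smul_sub]
    abel
  rw [h]
  exact hκ x y

/-- If `s • Id + A` is onto and `A` is `ρ`-monotone, then `g y ∈ s • y + A y` is solvable for
every `g` whose Lipschitz constant is below `s + ρ`. -/
theorem IsMonotoneSV.exists_sub_smul_mem [NormedAddCommGroup H] [InnerProductSpace ℝ H]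
    [CompleteSpace H] {ρ s k : ℝ} {A : H → Set H} (hA : IsMonotoneSV ρ A)
    (hs : ∀ x, ∃ y, x - s • y ∈ A y) {g : H → H} (hg : IsLipBound k g) (hk0 : 0 ≤ k)
    (hk : k < s + ρ) : ∃ y, g y - s • y ∈ A y := by
  choose j hj using hs
  have hpos : 0 < s + ρ := hk0.trans_lt hk
  have hjlip (x y : H) : (s + ρ) * ‖j x - j y‖ ≤ ‖x - y‖ := by
    have h := hA _ _ _ _ (hj x) (hj y)
    have e : x - s • j x - (y - s • j y) = (x - y) - s • (j x - j y) := by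
      rw [smul_sub]; abel
    rw [e, inner_sub_right, real_inner_smul_right, real_inner_self_eq_norm_sq] at h
    have h2 := real_inner_le_norm (j x - j y) (x - y)
    rcases (norm_nonneg (j x - j y)).eq_or_lt with h0 | h0
    · rw [← h0]; simp
    · refine le_of_mul_le_mul_left ?_ h0
      nlinarith
  have hc : ContractingWith (k / (s + ρ)).toNNReal (fun y => j (g y)) := by
    refine ⟨?_, LipschitzWith.of_dist_le_mul fun x y => ?_⟩
    · rw [← NNReal.coe_lt_coe, Real.coe_toNNReal _ (by positivity), NNReal.coe_one]
      exact (div_lt_one hpos).mpr hk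
    · rw [Real.coe_toNNReal _ (by positivity), dist_eq_norm, dist_eq_norm, div_mul_eq_mul_div,
        le_div_iff₀ hpos, mul_comm]
      exact (hjlip _ _).trans (hg x y)
  have hfix : j (g (hc.fixedPoint)) = hc.fixedPoint := hc.fixedPoint_isFixedPt
  refine ⟨hc.fixedPoint, ?_⟩
  have h := hj (g hc.fixedPoint)
  rwa [hfix] at h

/-- Surjectivity of `s • Id + A` for one `s > -ρ` yields it for arbitrarily large `s`. -/
theorem IsMonotoneSV.surjective_pow [NormedAddCommGroup H] [InnerProductSpace ℝ H]
    [CompleteSpace H] {ρ s : ℝ} {A : H → Set H} (hA : IsMonotoneSV ρ A)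
    (hs : ∀ x, ∃ y, x - s • y ∈ A y) (hpos : 0 < s + ρ) (n : ℕ) :
    ∀ x, ∃ y, x - ((3 / 2 : ℝ) ^ n * (s + ρ) - ρ) • y ∈ A y := by
  induction n with
  | zero => simpa using hs
  | succ n ih =>
    intro x
    have hp : 0 < (3 / 2 : ℝ) ^ n * (s + ρ) := by positivity
    obtain ⟨y, hy⟩ := hA.exists_sub_smul_mem ih (k := (3 / 2 : ℝ) ^ n * (s + ρ) / 2)
      (g := fun y => x - ((3 / 2 : ℝ) ^ n * (s + ρ) / 2) • y) (fun u v => by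
        rw [sub_sub_sub_cancel_left, ← smul_sub, norm_smul, Real.norm_of_nonneg (by positivity),
          norm_sub_rev]) (by positivity) (by linarith)
    refine ⟨y, ?_⟩
    convert hy using 1
    rw [sub_sub, ← add_smul]
    congr 2
    ring

/-- A `ρ`-monotone `A` with `s • Id + A` onto, plus a Lipschitz `F` with `F - μ • Id` monotone,
has a zero as soon as `ρ + μ > 0`. -/
theorem IsMonotoneSV.exists_zero_add [NormedAddCommGroup H] [InnerProductSpace ℝ H]
    [CompleteSpace H] {ρ μ l s : ℝ} {A : H → Set H} (hA : IsMonotoneSV ρ A)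
    (hs : ∀ x, ∃ y, x - s • y ∈ A y) (hpos : 0 < s + ρ) {F : H → H} (hF : IsLipBound l F)
    (hmono : ∀ x y, μ * ‖x - y‖ ^ 2 ≤ ⟪x - y, F x - F y⟫) (hρμ : 0 < ρ + μ) :
    ∃ y, -F y ∈ A y := by
  obtain ⟨n, hn⟩ := pow_unbounded_of_one_lt
    ((|ρ| + |μ| + l ^ 2 / (ρ + μ) + 1 + ρ) / (s + ρ)) (by norm_num : (1 : ℝ) < 3 / 2)
  rw [div_lt_iff₀ hpos] at hn
  have hsurj := hA.surjective_pow hs hpos n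
  set t : ℝ := (3 / 2 : ℝ) ^ n * (s + ρ) - ρ
  have hq : 0 ≤ l ^ 2 / (ρ + μ) := by positivity
  have ht1 : |ρ| + |μ| + l ^ 2 / (ρ + μ) + 1 < t := by linarith
  have htpos : 0 < t := by linarith [abs_nonneg ρ, abs_nonneg μ]
  have htρ : 0 < t + ρ := by linarith [neg_abs_le ρ, abs_nonneg μ]
  have htl : l ^ 2 < t * (ρ + μ) := by
    rw [← div_lt_iff₀ hρμ]; linarith [abs_nonneg ρ, abs_nonneg μ]
  have hg : IsLipBound (Real.sqrt (t ^ 2 - 2 * t * μ + l ^ 2)) (fun y => t • y - F y) := by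
    intro x y
    have e : t • x - F x - (t • y - F y) = t • (x - y) - (F x - F y) := by
      rw [smul_sub]; abel
    have hsq : ‖t • (x - y) - (F x - F y)‖ ^ 2 ≤
        (t ^ 2 - 2 * t * μ + l ^ 2) * ‖x - y‖ ^ 2 := by
      rw [norm_sub_sq_real, norm_smul, Real.norm_of_nonneg htpos.le, real_inner_smul_left]
      have h1 := mul_le_mul_of_nonneg_left (hmono x y) htpos.le
      have h2 := pow_le_pow_left₀ (norm_nonneg _) (hF x y) 2
      nlinarith
    show ‖t • x - F x - (t • y - F y)‖ ≤ _
    rw [e]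
    have h := Real.le_sqrt_of_sq_le hsq
    rwa [Real.sqrt_mul' _ (sq_nonneg _), Real.sqrt_sq (norm_nonneg _)] at h
  obtain ⟨y, hy⟩ := hA.exists_sub_smul_mem hsurj hg (Real.sqrt_nonneg _) (by
    rw [Real.sqrt_lt' htρ]; nlinarith [sq_nonneg ρ])
  exact ⟨y, by simpa using hy⟩

theorem IsCocoercive.lipschitz [NormedAddCommGroup H] [InnerProductSpace ℝ H] {β : ℝ} {C : H → H}
    (hC : IsCocoercive β C) (hβ : 0 < β) : IsLipBound β⁻¹ C := by
  intro x y
  have h1 := (hC x y).trans (real_inner_le_norm _ _)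
  rw [inv_mul_eq_div, le_div_iff₀ hβ]
  rcases (norm_nonneg (C x - C y)).eq_or_lt with h0 | h0
  · rw [← h0]; simp
  · refine le_of_mul_le_mul_left ?_ h0
    nlinarith

/-- One step of the forward-backward-forward iteration, seen from a reference point; all vectors
are differences with that point. -/
theorem norm_sq_fbf_step_le [NormedAddCommGroup H] [InnerProductSpace ℝ H]
    {γ β κ ρ μ : ℝ} (hγ : 0 < γ) (hβ : 0 < β) {p z d e c : H}
    (hA : γ * (ρ * ‖p‖ ^ 2) ≤ ⟪p, z - p - γ • c - γ • d⟫)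
    (hD : μ * ‖p‖ ^ 2 ≤ ⟪p, e⟫) (hC : β * ‖c‖ ^ 2 ≤ ⟪z, c⟫)
    (hlip : ‖d - e‖ ≤ κ * ‖z - p‖) :
    ‖p + γ • (d - e)‖ ^ 2 ≤ ‖z‖ ^ 2 -
      (1 - γ / (2 * β) - κ ^ 2 * γ ^ 2) * ‖z - p‖ ^ 2 - 2 * γ * (ρ + μ) * ‖p‖ ^ 2 := by
  have h1 := pow_le_pow_left₀ (norm_nonneg _) hlip 2
  have h2 : ‖z‖ ^ 2 = ‖p‖ ^ 2 + 2 * ⟪p, z - p⟫ + ‖z - p‖ ^ 2 := by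
    rw [← norm_add_sq_real, add_sub_cancel]
  have h3 : ⟪z, c⟫ = ⟪z - p, c⟫ + ⟪p, c⟫ := by rw [← inner_add_left, sub_add_cancel]
  have h4 := real_inner_le_norm (z - p) c
  have h5 : ‖z - p‖ * ‖c‖ - β * ‖c‖ ^ 2 ≤ ‖z - p‖ ^ 2 / (4 * β) := by
    rw [le_div_iff₀ (by positivity)]
    nlinarith [sq_nonneg (‖z - p‖ - 2 * β * ‖c‖)]
  have h6 : -⟪p, c⟫ ≤ ‖z - p‖ ^ 2 / (4 * β) := by linarith
  have h7 := mul_le_mul_of_nonneg_left h6 hγ.le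
  have h8 := mul_le_mul_of_nonneg_left hD hγ.le
  have h9 := mul_le_mul_of_nonneg_left h1 (sq_nonneg γ)
  rw [norm_add_sq_real, norm_smul, Real.norm_of_nonneg hγ.le, real_inner_smul_right,
    inner_sub_right]
  rw [inner_sub_right, inner_sub_right, real_inner_smul_right, real_inner_smul_right] at hA
  have h10 : γ / (2 * β) * ‖z - p‖ ^ 2 = 2 * (γ * (‖z - p‖ ^ 2 / (4 * β))) := by
    field_simp; ring
  nlinarith

theorem chiConst_le (β ρ κ : ℝ) :
    chiConst β ρ κ ≤ 4 * β / (1 + Real.sqrt (1 + 16 * β ^ 2 * κ ^ 2)) := by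
  unfold chiConst
  split_ifs
  · exact le_rfl
  · exact min_le_left _ _

theorem one_add_mul_pos_of_lt_chiConst {β ρ κ γ : ℝ} (hγ : 0 < γ) (h : γ < chiConst β ρ κ) :
    0 < 1 + γ * ρ := by
  unfold chiConst at h
  split_ifs at h with hρ
  · positivity
  · push Not at hρ
    have h1 := h.trans_le (min_le_right _ _)
    rw [lt_div_iff_of_neg hρ] at h1
    linarith

/-- The first bound in `χ` is the positive root of `1 - γ / (2β) - κ² γ²`. -/
theorem chi_root {β κ : ℝ} (hβ : 0 < β) {x : ℝ}
    (hx : x = 4 * β / (1 + Real.sqrt (1 + 16 * β ^ 2 * κ ^ 2))) :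
    1 - x / (2 * β) - κ ^ 2 * x ^ 2 = 0 := by
  have hs : Real.sqrt (1 + 16 * β ^ 2 * κ ^ 2) ^ 2 = 1 + 16 * β ^ 2 * κ ^ 2 :=
    Real.sq_sqrt (by positivity)
  have hs0 := Real.sqrt_nonneg (1 + 16 * β ^ 2 * κ ^ 2)
  set r := Real.sqrt (1 + 16 * β ^ 2 * κ ^ 2)
  have hr : 0 < 1 + r := by linarith
  rw [hx]
  field_simp
  nlinarith

theorem statement10 {H G : Type*} [NormedAddCommGroup H] [InnerProductSpace ℝ H] [CompleteSpace H]
    [NormedAddCommGroup G] [InnerProductSpace ℝ G] [CompleteSpace G]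
    (ρ β ζ α : ℝ) (A : H → Set H) (C : H → H) (B : G → G)
    (L : H →L[ℝ] G) (K : G →L[ℝ] H) (c : G)
    (hA : IsMaxMonotoneSV ρ A)
    (hβ : 0 < β) (hC : IsCocoercive β C)
    (hζ : 0 < ζ) (hBmono : IsMonotoneMap B) (hBlip : IsLipBound ζ B)
    (hα : 0 ≤ α)
    (ζt : ℝ)
    (hζt : IsLipConst ζt (fun x : H => (ContinuousLinearMap.adjoint L - K) (B (L x))))
    (κ : ℝ) (hκ : IsLipConst κ (fun x : H => K (α • L x + B (L x))))
    (hρhat : 0 < (ρ + α * lambdaMin L K - ζt))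
    (ε γ : ℝ) (hε0 : 0 < ε) (hεχ : ε < chiConst β ρ κ / 2)
    (hγ1 : ε ≤ γ) (hγ2 : γ ≤ chiConst β ρ κ - ε)
    (J : H → H) (hJ : ∀ x y : H, J x = y ↔ x - y ∈ γ • A y)
    (S T : H → H)
    (hSdef : ∀ z, S z = J (z - γ • (C z + Dop α L c B K z)))
    (hTdef : ∀ z, T z = S z - γ • Dop α L c B K (S z) + γ • Dop α L c B K z) :
    ∃ zs : H, T zs = zs ∧ (∀ w : H, T w = w → w = zs) ∧
      ∀ z : H, ‖T z - zs‖ ≤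
        Real.sqrt (1 - ε * min (κ ^ 2 * ε / 2) (ρ + α * lambdaMin L K - ζt)) * ‖z - zs‖ := by
  have hγ : 0 < γ := hε0.trans_le hγ1
  have hD := inner_Dop_sub_ge c hBmono hα hζt.1
  have hDlip := norm_Dop_sub_le c hκ.1
  set D := Dop α L c B K
  set μ := α * lambdaMin L K - ζt with hμ
  have hρμ : ρ + α * lambdaMin L K - ζt = ρ + μ := by rw [hμ]; ring
  rw [hρμ] at hρhat ⊢
  have hpos := one_add_mul_pos_of_lt_chiConst hγ (by linarith : γ < chiConst β ρ κ)
  have hJA (x y : H) : J x = y ↔ γ⁻¹ • (x - y) ∈ A y := by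
    rw [hJ, Set.mem_smul_set_iff_inv_smul_mem₀ hγ.ne']
  obtain ⟨zs, hzs⟩ : ∃ y, -(C y + D y) ∈ A y := by
    refine hA.1.exists_zero_add (s := γ⁻¹) (μ := μ) (l := β⁻¹ + κ) (F := fun y => C y + D y)
      (fun x => ⟨J (γ • x), ?_⟩) ?_ (fun x y => ?_) (fun x y => ?_) hρhat
    · have h := (hJA (γ • x) _).mp rfl
      rwa [smul_sub, inv_smul_smul₀ hγ.ne'] at h
    · have : γ⁻¹ + ρ = (1 + γ * ρ) / γ := by field_simp
      rw [this]; positivity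
    · show ‖C x + D x - (C y + D y)‖ ≤ _
      rw [add_sub_add_comm, add_mul]
      exact (norm_add_le _ _).trans (add_le_add (hC.lipschitz hβ x y) (hDlip x y))
    · show _ ≤ ⟪x - y, C x + D x - (C y + D y)⟫
      rw [add_sub_add_comm, inner_add_right]
      have := hC x y
      have : 0 ≤ β * ‖C x - C y‖ ^ 2 := by positivity
      linarith [hD x y]
  have hfix : T zs = zs := by
    have hS : S zs = zs := by
      rw [hSdef, hJA]
      convert hzs using 1
      rw [sub_sub_cancel_left, smul_neg, inv_smul_smul₀ hγ.ne']
    rw [hTdef, hS, sub_add_cancel]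
  have key (z : H) := by
    have hmem := (hJA (z - γ • (C z + D z)) (S z)).mp (hSdef z).symm
    have h := mul_le_mul_of_nonneg_left (hA.1 _ _ _ _ hmem hzs) hγ.le
    rw [← real_inner_smul_right] at h
    have e : γ • (γ⁻¹ • (z - γ • (C z + D z) - S z) - -(C zs + D zs)) =
        (z - zs) - (S z - zs) - γ • (C z - C zs) - γ • (D z - D zs) := by
      rw [smul_sub, smul_inv_smul₀ hγ.ne']
      simp only [smul_sub, smul_add, smul_neg]
      abel
    rw [e] at h
    have h' := norm_sq_fbf_step_le (κ := κ) (e := D (S z) - D zs) hγ hβ h (hD _ _) (hC z zs) (by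
      simpa using hDlip z (S z))
    have e2 : S z - zs + γ • (D z - D zs - (D (S z) - D zs)) = T z - zs := by
      rw [hTdef, sub_sub_sub_cancel_right, smul_sub]; abel
    rw [e2, sub_sub_sub_cancel_right] at h'
    exact h'
  set δ := 1 - γ / (2 * β) - κ ^ 2 * γ ^ 2 with hδ
  have hδ' : κ ^ 2 * ε ^ 2 ≤ δ ∧ 0 < δ := by
    obtain ⟨x, hx⟩ : ∃ x, x = 4 * β / (1 + Real.sqrt (1 + 16 * β ^ 2 * κ ^ 2)) := ⟨_, rfl⟩
    have hroot := chi_root hβ hx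
    have hle : ε ≤ x - γ := by linarith [chiConst_le β ρ κ]
    have hδx : δ = (x - γ) / (2 * β) + κ ^ 2 * ((x - γ) * (x + γ)) := by
      have : (x - γ) / (2 * β) = x / (2 * β) - γ / (2 * β) := sub_div _ _ _
      rw [this, hδ]; linear_combination hroot
    have hxγ : 0 < x - γ := hε0.trans_le hle
    have h1 : 0 < (x - γ) / (2 * β) := by positivity
    have h2 : ε ^ 2 ≤ (x - γ) * (x + γ) := by nlinarith
    have h3 := mul_le_mul_of_nonneg_left h2 (sq_nonneg κ)
    have h4 : 0 ≤ κ ^ 2 * ε ^ 2 := by positivity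
    constructor <;> linarith
  refine ⟨zs, hfix, fun w hw => ?_, fun z => ?_⟩
  · have h := key w
    rw [hw] at h
    have h1 : 0 ≤ δ * ‖w - S w‖ ^ 2 := mul_nonneg hδ'.2.le (sq_nonneg _)
    have hc : 0 < 2 * γ * (ρ + μ) := by positivity
    have h2 : 0 ≤ 2 * γ * (ρ + μ) * ‖S w - zs‖ ^ 2 := mul_nonneg hc.le (sq_nonneg _)
    have h3 : δ * ‖w - S w‖ ^ 2 = 0 := by linarith
    have h4 : 2 * γ * (ρ + μ) * ‖S w - zs‖ ^ 2 = 0 := by linarith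
    have h5 : w = S w := by simpa [hδ'.2.ne', sub_eq_zero] using h3
    rw [mul_eq_zero, or_iff_right hc.ne', sq_eq_zero_iff, norm_eq_zero, sub_eq_zero] at h4
    rw [h5, h4]
  · set m := min (κ ^ 2 * ε / 2) (ρ + μ)
    have hm0 : 0 ≤ m := le_min (by positivity) hρhat.le
    have h1 : 2 * (ε * m) ≤ δ := by
      nlinarith [mul_le_mul_of_nonneg_left (min_le_left (κ ^ 2 * ε / 2) (ρ + μ)) hε0.le, hδ'.1]
    have h2 : 2 * (ε * m) ≤ 2 * γ * (ρ + μ) := by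
      have := mul_le_mul hγ1 (min_le_right (κ ^ 2 * ε / 2) (ρ + μ)) hm0 hγ.le
      linarith
    have h3 : ‖z - zs‖ ^ 2 ≤ 2 * (‖z - S z‖ ^ 2 + ‖S z - zs‖ ^ 2) := by
      have := pow_le_pow_left₀ (norm_nonneg _) (norm_sub_le_norm_sub_add_norm_sub z (S z) zs) 2
      nlinarith [sq_nonneg (‖z - S z‖ - ‖S z - zs‖)]
    have h4 := mul_le_mul_of_nonneg_right h1 (sq_nonneg ‖z - S z‖)
    have h5 := mul_le_mul_of_nonneg_right h2 (sq_nonneg ‖S z - zs‖)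
    have h6 := mul_le_mul_of_nonneg_left h3 (mul_nonneg hε0.le hm0)
    have hsq : ‖T z - zs‖ ^ 2 ≤ (1 - ε * m) * ‖z - zs‖ ^ 2 := by linarith [key z]
    have h := Real.le_sqrt_of_sq_le hsq
    rwa [Real.sqrt_mul' _ (sq_nonneg _), Real.sqrt_sq (norm_nonneg _)] at h
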